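/- arXiv:0807.0115 — 3 statements merged into one kernel-verified Lean document; each statement's English description precedes it below -/
import Mathlib

section
/- The functions ξ ↦ λ₀^{−n} gⁿ(ξ) (where gⁿ is the n-th iterate of g) converge uniformly on [0,1] to a function γ which is a C^{1+ε} diffeomorphism of [0,1] onto its image, satisfying γ(0) = 0, γ'(0) = 1, and γ(g(ξ)) = λ₀·γ(ξ) for all ξ ∈ [0,1]. -/
theorem abs_exp_sub_exp_le {a b B : ℝ} (ha : a ≤ B) (hb : b ≤ B) :
    |Real.exp a - Real.exp b| ≤ Real.exp B * |a - b| := by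
  wlog h : b ≤ a generalizing a b
  · rw [abs_sub_comm, abs_sub_comm a]
    exact this hb ha (le_of_not_ge h)
  rw [abs_of_nonneg (sub_nonneg.2 (Real.exp_le_exp.2 h)), abs_of_nonneg (sub_nonneg.2 h)]
  have h1 : Real.exp b = Real.exp a * Real.exp (b - a) := by
    rw [← Real.exp_add]; congr 1; ring
  have h2 := Real.add_one_le_exp (b - a)
  calc Real.exp a - Real.exp b = Real.exp a * (1 - Real.exp (b - a)) := by rw [h1]; ring
    _ ≤ Real.exp a * (a - b) :=
      mul_le_mul_of_nonneg_left (by linarith) (Real.exp_pos a).le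
    _ ≤ Real.exp B * (a - b) := by
      have := sub_nonneg.2 h
      gcongr

theorem abs_log_sub_log_le {a b m : ℝ} (hm : 0 < m) (ha : m ≤ a) (hb : m ≤ b) :
    |Real.log a - Real.log b| ≤ |a - b| / m := by
  wlog h : b ≤ a generalizing a b
  · rw [abs_sub_comm, abs_sub_comm a]
    exact this hb ha (le_of_not_ge h)
  have hb0 : 0 < b := hm.trans_le hb
  have ha0 : 0 < a := hm.trans_le ha
  rw [abs_of_nonneg (sub_nonneg.2 (Real.log_le_log hb0 h)), abs_of_nonneg (sub_nonneg.2 h),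
    ← Real.log_div ha0.ne' hb0.ne']
  calc Real.log (a / b) ≤ a / b - 1 := Real.log_le_sub_one_of_pos (by positivity)
    _ = (a - b) / b := by field_simp
    _ ≤ (a - b) / m := by
      have := sub_nonneg.2 h
      gcongr

/-- A real function satisfying a Hölder estimate on a set is continuous on it. -/
theorem continuousOn_of_abs_sub_le_rpow {f : ℝ → ℝ} {s : Set ℝ} {C ε : ℝ} (hε : 0 < ε)
    (h : ∀ x ∈ s, ∀ y ∈ s, |f x - f y| ≤ C * |x - y| ^ ε) : ContinuousOn f s := by
  intro x hx
  rw [ContinuousWithinAt, tendsto_iff_dist_tendsto_zero]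
  have hlim : Filter.Tendsto (fun y => C * |y - x| ^ ε) (nhdsWithin x s) (nhds 0) := by
    have hc : Continuous fun y : ℝ => C * |y - x| ^ ε := by
      have := hε.le
      fun_prop (disch := simp [this])
    have := hc.tendsto x
    simp only [sub_self, abs_zero, Real.zero_rpow hε.ne', mul_zero] at this
    exact this.mono_left nhdsWithin_le_nhds
  refine squeeze_zero' (Filter.Eventually.of_forall fun _ => dist_nonneg) ?_ hlim
  filter_upwards [self_mem_nhdsWithin] with y hy
  exact h y hy x hx

/-- The chain rule for iterates of a self-map of a set. -/
theorem hasDerivWithinAt_iterate {f f' : ℝ → ℝ} {s : Set ℝ} (hmaps : Set.MapsTo f s s)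
    (hderiv : ∀ x ∈ s, HasDerivWithinAt f (f' x) s x) (n : ℕ) {x : ℝ} (hx : x ∈ s) :
    HasDerivWithinAt f^[n] (∏ k ∈ Finset.range n, f' (f^[k] x)) s x := by
  induction n with
  | zero => simpa using hasDerivWithinAt_id x s
  | succ n ih =>
    rw [Function.iterate_succ', Finset.prod_range_succ, mul_comm]
    exact (hderiv _ (hmaps.iterate n hx)).comp x ih (hmaps.iterate n)

/-- Iterates of a map that is `κ`-Lipschitz on an invariant set are `κ ^ n`-Lipschitz there. -/
theorem abs_iterate_sub_le {f : ℝ → ℝ} {s : Set ℝ} {κ : ℝ} (hκ : 0 ≤ κ)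
    (hmaps : Set.MapsTo f s s) (h : ∀ x ∈ s, ∀ y ∈ s, |f x - f y| ≤ κ * |x - y|) (n : ℕ)
    {x y : ℝ} (hx : x ∈ s) (hy : y ∈ s) : |f^[n] x - f^[n] y| ≤ κ ^ n * |x - y| := by
  induction n with
  | zero => simp
  | succ n ih =>
    rw [Function.iterate_succ_apply', Function.iterate_succ_apply', pow_succ', mul_assoc]
    exact (h _ (hmaps.iterate n hx) _ (hmaps.iterate n hy)).trans (by gcongr)


/-- Linearisation.  Let `g : [0,1] → [0,1]` be `C^{1+ε}` with
`g(0) = 0` and `0 < g'(ξ) < 1` on `[0,1]`, and write `λ₀ := g'(0)`.  Then the functions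
`ξ ↦ λ₀^{-n} gⁿ(ξ)` converge uniformly on `[0,1]` to a `C^{1+ε}` diffeomorphism `γ` onto
its image, with `γ(0) = 0`, `γ'(0) = 1`, and `γ(g(ξ)) = λ₀·γ(ξ)` on `[0,1]`. -/
theorem statement_13 (ε : ℝ) (hε : 0 < ε) (g g' : ℝ → ℝ)
    (hmaps : Set.MapsTo g (Set.Icc (0 : ℝ) 1) (Set.Icc (0 : ℝ) 1))
    (hderiv : ∀ ξ ∈ Set.Icc (0 : ℝ) 1, HasDerivWithinAt g (g' ξ) (Set.Icc (0 : ℝ) 1) ξ)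
    (hholder : ∃ C > 0, ∀ ξ ∈ Set.Icc (0 : ℝ) 1, ∀ η ∈ Set.Icc (0 : ℝ) 1,
      |g' ξ - g' η| ≤ C * |ξ - η| ^ ε)
    (h0 : g 0 = 0)
    (hcontr : ∀ ξ ∈ Set.Icc (0 : ℝ) 1, g' ξ ∈ Set.Ioo (0 : ℝ) 1) :
    ∃ γ γ' : ℝ → ℝ,
      TendstoUniformlyOn (fun n ξ => g^[n] ξ / (g' 0) ^ n) γ Filter.atTop
        (Set.Icc (0 : ℝ) 1) ∧
      Set.InjOn γ (Set.Icc (0 : ℝ) 1) ∧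
      (∀ ξ ∈ Set.Icc (0 : ℝ) 1, HasDerivWithinAt γ (γ' ξ) (Set.Icc (0 : ℝ) 1) ξ) ∧
      (∀ ξ ∈ Set.Icc (0 : ℝ) 1, γ' ξ ≠ 0) ∧
      (∃ C > 0, ∀ ξ ∈ Set.Icc (0 : ℝ) 1, ∀ η ∈ Set.Icc (0 : ℝ) 1,
        |γ' ξ - γ' η| ≤ C * |ξ - η| ^ ε) ∧
      γ 0 = 0 ∧ γ' 0 = 1 ∧
      ∀ ξ ∈ Set.Icc (0 : ℝ) 1, γ (g ξ) = g' 0 * γ ξ := by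
  set I := Set.Icc (0 : ℝ) 1 with hI
  obtain ⟨C, hC, hH⟩ := hholder
  have h0I : (0 : ℝ) ∈ I := by simp [hI]
  have hIc : IsCompact I := isCompact_Icc
  have hconv : Convex ℝ I := convex_Icc 0 1
  have hg'c : ContinuousOn g' I := continuousOn_of_abs_sub_le_rpow hε hH
  obtain ⟨xm, hxm, hmin⟩ := hIc.exists_isMinOn ⟨0, h0I⟩ hg'c
  obtain ⟨xM, hxM, hmax⟩ := hIc.exists_isMaxOn ⟨0, h0I⟩ hg'c
  set m := g' xm
  set κ := g' xM
  have hm : 0 < m := (hcontr _ hxm).1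
  have hκ0 : 0 < κ := (hcontr _ hxM).1
  have hκ1 : κ < 1 := (hcontr _ hxM).2
  have hmle : ∀ x ∈ I, m ≤ g' x := fun x hx => hmin hx
  have hleκ : ∀ x ∈ I, g' x ≤ κ := fun x hx => hmax hx
  have hlip : ∀ x ∈ I, ∀ y ∈ I, |g x - g y| ≤ κ * |x - y| := fun x hx y hy =>
    hconv.norm_image_sub_le_of_norm_hasDerivWithin_le hderiv
      (fun z hz => by rw [Real.norm_of_nonneg (hcontr z hz).1.le]; exact hleκ z hz) hy hx
  have hit : ∀ n, ∀ x ∈ I, g^[n] x ∈ I := fun n x hx => hmaps.iterate n hx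
  have hit0 : ∀ n, g^[n] 0 = 0 := fun n => Function.iterate_fixed h0 n
  set q := κ ^ ε
  have hq0 : 0 < q := Real.rpow_pos_of_pos hκ0 ε
  have hq1 : q < 1 := Real.rpow_lt_one hκ0.le hκ1 hε
  set L := C / m
  have hL : 0 < L := by positivity
  have hlam : 0 < g' 0 := (hcontr 0 h0I).1
  let v : ℕ → ℝ → ℝ := fun k x => Real.log (g' (g^[k] x)) - Real.log (g' 0)
  have hv : ∀ k, ∀ x ∈ I, ∀ y ∈ I, |v k x - v k y| ≤ L * |x - y| ^ ε * q ^ k := by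
    intro k x hx y hy
    have h1 := abs_log_sub_log_le hm (hmle _ (hit k x hx)) (hmle _ (hit k y hy))
    have h2 := hH _ (hit k x hx) _ (hit k y hy)
    have h3 := abs_iterate_sub_le hκ0.le hmaps hlip k hx hy
    have h4 : (κ ^ k * |x - y|) ^ ε = q ^ k * |x - y| ^ ε := by
      rw [Real.mul_rpow (by positivity) (abs_nonneg _), ← Real.rpow_natCast_mul hκ0.le,
        mul_comm (k : ℝ), Real.rpow_mul_natCast hκ0.le]
    calc |v k x - v k y| = |Real.log (g' (g^[k] x)) - Real.log (g' (g^[k] y))| := by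
          simp only [v, sub_sub_sub_cancel_right]
      _ ≤ (C * (κ ^ k * |x - y|) ^ ε) / m := by
          refine h1.trans ?_
          gcongr
          exact h2.trans (by gcongr)
      _ = L * |x - y| ^ ε * q ^ k := by rw [h4]; simp only [L]; ring
  have hv0 : ∀ k, v k 0 = 0 := fun k => by simp [v, hit0]
  have hvb : ∀ k, ∀ x ∈ I, |v k x| ≤ L * q ^ k := by
    intro k x hx
    have h1 := hv k x hx 0 h0I
    rw [hv0, sub_zero, sub_zero] at h1
    refine h1.trans ?_
    have : |x| ^ ε ≤ 1 := Real.rpow_le_one (abs_nonneg _)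
      (abs_le.2 ⟨by linarith [hx.1], hx.2⟩) hε.le
    gcongr
    nlinarith
  have hgeo : Summable fun k : ℕ => q ^ k := summable_geometric_of_lt_one hq0.le hq1
  have hsum : ∀ x ∈ I, Summable fun k => v k x := fun x hx =>
    Summable.of_norm_bounded (hgeo.mul_left L) (fun k => hvb k x hx)
  let S : ℝ → ℝ := fun x => ∑' k, v k x
  have hSn : ∀ n, ∀ x ∈ I,
      |∑ k ∈ Finset.range n, v k x - S x| ≤ L * q ^ n / (1 - q) := by
    intro n x hx
    refine dist_le_of_le_geometric_of_tendsto q L hq1 (fun n => ?_)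
      (hsum x hx).hasSum.tendsto_sum_nat n
    rw [Finset.sum_range_succ, dist_self_add_right]
    exact hvb n x hx
  set B := L / (1 - q)
  have hq1' : 0 < 1 - q := by linarith
  have hSB : ∀ x ∈ I, S x ≤ B := by
    intro x hx
    have := hSn 0 x hx
    simp only [Finset.range_zero, Finset.sum_empty, zero_sub, abs_neg, pow_zero, mul_one] at this
    exact (le_abs_self _).trans this
  have hSnB : ∀ n, ∀ x ∈ I, ∑ k ∈ Finset.range n, v k x ≤ B := by
    intro n x hx
    calc ∑ k ∈ Finset.range n, v k x ≤ ∑ k ∈ Finset.range n, L * q ^ k :=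
          Finset.sum_le_sum fun k _ => (le_abs_self _).trans (hvb k x hx)
      _ ≤ ∑' k, L * q ^ k := (hgeo.mul_left L).sum_le_tsum _ fun k _ => by positivity
      _ = B := by rw [tsum_mul_left, tsum_geometric_of_lt_one hq0.le hq1]; rfl
  have hSH : ∀ x ∈ I, ∀ y ∈ I, |S x - S y| ≤ B * |x - y| ^ ε := by
    intro x hx y hy
    have h1 : S x - S y = ∑' k, (v k x - v k y) := ((hsum x hx).tsum_sub (hsum y hy)).symm
    rw [h1, ← Real.norm_eq_abs]
    refine (tsum_of_norm_bounded ((hasSum_geometric_of_lt_one hq0.le hq1).mul_left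
      (L * |x - y| ^ ε)) (f := fun k => v k x - v k y)
      (fun k => hv k x hx y hy)).trans (le_of_eq ?_)
    simp only [B]; ring
  let G : ℝ → ℝ := fun x => Real.exp (S x)
  have hGH : ∀ x ∈ I, ∀ y ∈ I, |G x - G y| ≤ Real.exp B * B * |x - y| ^ ε := by
    intro x hx y hy
    refine (abs_exp_sub_exp_le (hSB x hx) (hSB y hy)).trans ?_
    rw [mul_assoc]
    gcongr
    exact hSH x hx y hy
  have hGc : ContinuousOn G I := continuousOn_of_abs_sub_le_rpow hε hGH
  let E : ℝ → ℝ := Set.IccExtend (zero_le_one' ℝ) (I.domRestrict G)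
  have hEc : Continuous E := hGc.domRestrict.Icc_extend'
  have hEG : ∀ x ∈ I, E x = G x := fun x hx => Set.IccExtend_of_mem _ _ hx
  let γ : ℝ → ℝ := fun x => ∫ t in (0 : ℝ)..x, E t
  have hγd : ∀ x ∈ I, HasDerivWithinAt γ (G x) I x := fun x hx => by
    rw [← hEG x hx]
    exact (hEc.integral_hasStrictDerivAt 0 x).hasDerivAt.hasDerivWithinAt
  have hγ0 : γ 0 = 0 := intervalIntegral.integral_same
  let f : ℕ → ℝ → ℝ := fun n x => g^[n] x / g' 0 ^ n
  have hfd : ∀ n, ∀ x ∈ I,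
      HasDerivWithinAt (f n) (Real.exp (∑ k ∈ Finset.range n, v k x)) I x := by
    intro n x hx
    have h1 := (hasDerivWithinAt_iterate hmaps hderiv n hx).div_const (g' 0 ^ n)
    suffices h : Real.exp (∑ k ∈ Finset.range n, v k x) =
        (∏ k ∈ Finset.range n, g' (g^[k] x)) / g' 0 ^ n by rw [h]; exact h1
    have h2 : g' 0 ^ n = ∏ _k ∈ Finset.range n, g' 0 := by simp
    rw [Real.exp_sum, h2, ← Finset.prod_div_distrib]
    refine Finset.prod_congr rfl fun k _ => ?_
    rw [Real.exp_sub, Real.exp_log (hcontr _ (hit k x hx)).1, Real.exp_log hlam]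
  have hfγ : ∀ n, ∀ x ∈ I, |f n x - γ x| ≤ Real.exp B * (L * q ^ n / (1 - q)) := by
    intro n x hx
    have h1 := hconv.norm_image_sub_le_of_norm_hasDerivWithin_le
      (fun y hy => (hfd n y hy).sub (hγd y hy))
      (C := Real.exp B * (L * q ^ n / (1 - q)))
      (fun y hy => (abs_exp_sub_exp_le (hSnB n y hy) (hSB y hy)).trans (by
        gcongr
        exact hSn n y hy)) h0I hx
    have h2 : (f n - γ) 0 = 0 := by simp [f, hit0, hγ0]
    rw [h2, sub_zero, sub_zero, Real.norm_of_nonneg hx.1] at h1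
    refine h1.trans (mul_le_of_le_one_right (by positivity) hx.2)
  have hunif : TendstoUniformlyOn f γ Filter.atTop I := by
    rw [Metric.tendstoUniformlyOn_iff]
    intro δ hδ
    have hlim : Filter.Tendsto (fun n : ℕ => Real.exp B * (L * q ^ n / (1 - q)))
        Filter.atTop (nhds 0) := by
      simpa using (((tendsto_pow_atTop_nhds_zero_of_lt_one hq0.le hq1).const_mul L).div_const
        (1 - q)).const_mul (Real.exp B)
    filter_upwards [hlim.eventually_lt_const hδ] with n hn x hx
    rw [dist_comm]
    exact (hfγ n x hx).trans_lt hn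
  refine ⟨γ, G, hunif, ?_, hγd, fun x _ => (Real.exp_pos _).ne',
    ⟨Real.exp B * B, by positivity, hGH⟩, hγ0, ?_, ?_⟩
  · exact (strictMonoOn_of_hasDerivWithinAt_pos hconv
      (fun x hx => (hγd x hx).continuousWithinAt)
      (fun x hx => (hγd x (interior_subset hx)).mono interior_subset)
      fun x _ => Real.exp_pos _).injOn
  · simp [G, S, hv0]
  · intro x hx
    have h1 := hunif.tendsto_at (hmaps hx)
    have h2 := ((hunif.tendsto_at hx).comp (Filter.tendsto_add_atTop_nat 1)).const_mul (g' 0)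
    refine tendsto_nhds_unique h1 (h2.congr fun n => ?_)
    simp only [Function.comp_apply, f, Function.iterate_succ_apply, pow_succ]
    field_simp
end

section
/- Suppose there exists ρ ≥ 1 such that S_nψ(x) ≤ ρ^{-1}·S_nφ(x) for all x ∈ Σ and all n ≥ 1 (equivalently, S_nψ(x)/S_nφ(x) ≥ 1/ρ, both sums being negative). Then Θ is Hölder continuous with exponent 1/ρ: there exists a constant C > 0 such that |Θ(ξ) − Θ(η)| ≤ C·|ξ − η|^{1/ρ} for all ξ, η ∈ 𝒰. -/
open Set Filter Topology

noncomputable section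

/-- The unit interval `𝒰 = [0,1]`. -/
abbrev UI : Set ℝ := Set.Icc 0 1

/-- An expanding piecewise `C^{1+ε}` map of the unit interval, presented through its
`d` increasing full inverse branches (ordered left to right, images covering `𝒰` with
pairwise disjoint interiors), each branch being a `C^{1+ε}` diffeomorphism onto its image
whose derivative is `ε`-Hölder continuous with values in `(0,1)`. -/
structure ExpMap (d : ℕ) (ε : ℝ) : Type where
  toFun : ℝ → ℝ
  branch : Fin d → ℝ → ℝ
  branchDeriv : Fin d → ℝ → ℝ
  maps_to : Set.MapsTo toFun UI UI
  branch_maps_to : ∀ a, Set.MapsTo (branch a) UI UI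
  branch_mono : ∀ a, StrictMonoOn (branch a) UI
  right_inv : ∀ a, ∀ ξ ∈ Set.Ico (0 : ℝ) 1, toFun (branch a ξ) = ξ
  map_one : toFun 1 = 1
  branch_hasDeriv : ∀ a, ∀ ξ ∈ UI, HasDerivWithinAt (branch a) (branchDeriv a ξ) UI ξ
  branchDeriv_mem : ∀ a, ∀ ξ ∈ UI, branchDeriv a ξ ∈ Set.Ioo (0 : ℝ) 1
  branchDeriv_holder : ∀ a, ∃ C > 0, ∀ ξ ∈ UI, ∀ η ∈ UI,
      |branchDeriv a ξ - branchDeriv a η| ≤ C * |ξ - η| ^ ε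
  ordered : ∀ a b : Fin d, a < b → ∀ ξ ∈ UI, ∀ η ∈ UI, branch a ξ ≤ branch b η
  cover : UI ⊆ ⋃ a, branch a '' UI

/-- The shift map on `Σ = {1,…,d}^ℕ` (`x n` represents the letter `x_{n+1}`). -/
def shift {d : ℕ} (x : ℕ → Fin d) : ℕ → Fin d := fun n => x (n + 1)

/-- The cylinder set `[x_1 … x_n]`. -/
def cyl {d : ℕ} (x : ℕ → Fin d) (n : ℕ) : Set (ℕ → Fin d) := {y | ∀ m < n, y m = x m}

/-- Finite approximations `S_{x_1}^{-1} ∘ ⋯ ∘ S_{x_n}^{-1}(0)` to the coding map. -/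
def approx {d : ℕ} {ε : ℝ} (S : ExpMap d ε) (x : ℕ → Fin d) (n : ℕ) : ℝ :=
  (List.range n).foldr (fun m ξ => S.branch (x m) ξ) 0

/-- The coding map `π_S : Σ → 𝒰`. -/
def proj {d : ℕ} {ε : ℝ} (S : ExpMap d ε) (x : ℕ → Fin d) : ℝ := ⨆ n, approx S x n

/-- The potential `φ(x) = log (S_{x_1}^{-1})'(π_S(σ x))` associated with `S`. -/
def pot {d : ℕ} {ε : ℝ} (S : ExpMap d ε) (x : ℕ → Fin d) : ℝ :=
  Real.log (S.branchDeriv (x 0) (proj S (shift x)))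

/-- Birkhoff sums `S_n f(x) = ∑_{m=0}^{n-1} f(σ^m x)`. -/
def birk {d : ℕ} (f : (ℕ → Fin d) → ℝ) (n : ℕ) (x : ℕ → Fin d) : ℝ :=
  ∑ m ∈ Finset.range n, f (shift^[m] x)

/-- The difference quotient `D_Θ(ξ, η) = (Θ(ξ) - Θ(η))/(ξ - η)`. -/
def DQ (Θ : ℝ → ℝ) (ξ η : ℝ) : ℝ := (Θ ξ - Θ η) / (ξ - η)

/-- `Θ` is the conjugacy between `S` and `T` : an increasing homeomorphism of `𝒰`
with `T ∘ Θ = Θ ∘ S`. -/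
def IsConjugacy {d : ℕ} {ε : ℝ} (S T : ExpMap d ε) (Θ : ℝ → ℝ) : Prop :=
  StrictMonoOn Θ UI ∧ ContinuousOn Θ UI ∧ Θ '' UI = UI ∧
    ∀ ξ ∈ UI, T.toFun (Θ ξ) = Θ (S.toFun ξ)

/-- `x` has an `i`-block of length `k` at the `n`-th level:
`x_{n+1} = ⋯ = x_{n+k} = i` and `x_{n+k+1} ≠ i`. -/
def HasBlock {d : ℕ} (x : ℕ → Fin d) (i : Fin d) (k n : ℕ) : Prop :=
  (∀ m < k, x (n + m) = i) ∧ x (n + k) ≠ i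

/-- `x` is eventually constant. -/
def EvConst {d : ℕ} (x : ℕ → Fin d) : Prop := ∃ N : ℕ, ∃ i : Fin d, ∀ n ≥ N, x n = i

/-- `Θ'(ξ)` exists in the generalised sense: `lim_{η→ξ} D_Θ(ξ,η)` exists in `[0,∞]`
(with one-sided limits at the boundary points). -/
def GenDeriv (Θ : ℝ → ℝ) (ξ : ℝ) : Prop :=
  (∃ L : ℝ, Filter.Tendsto (fun η => DQ Θ ξ η) (nhdsWithin ξ (UI \ {ξ})) (nhds L)) ∨
    Filter.Tendsto (fun η => DQ Θ ξ η) (nhdsWithin ξ (UI \ {ξ})) Filter.atTop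

/-- The composition `S_{x_1}^{-1} ∘ ⋯ ∘ S_{x_n}^{-1}` of inverse branches along the first `n`
letters of `x`. -/
def wordMap {d : ℕ} {ε : ℝ} (S : ExpMap d ε) : (ℕ → Fin d) → ℕ → ℝ → ℝ
  | _, 0, ξ => ξ
  | x, n + 1, ξ => S.branch (x 0) (wordMap S (shift x) n ξ)

theorem birk_succ {d : ℕ} (f : (ℕ → Fin d) → ℝ) (n : ℕ) (x : ℕ → Fin d) :
    birk f (n + 1) x = f x + birk f n (shift x) := by
  simp only [birk, Finset.sum_range_succ', Function.iterate_succ_apply, Function.iterate_zero,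
    id_eq]
  ring

theorem abs_log_sub_log_le_s15 {m u v : ℝ} (hm : 0 < m) (hu : m ≤ u) (hv : m ≤ v) :
    |Real.log u - Real.log v| ≤ |u - v| / m := by
  have log_sub_le : ∀ u v : ℝ, m ≤ u → m ≤ v → Real.log u - Real.log v ≤ |u - v| / m := by
    intro u v hu hv
    have hu0 := hm.trans_le hu
    have hv0 := hm.trans_le hv
    rw [← Real.log_div hu0.ne' hv0.ne']
    calc Real.log (u / v) ≤ u / v - 1 := Real.log_le_sub_one_of_pos (by positivity)
      _ = (u - v) / v := by field_simp
      _ ≤ |u - v| / v := by gcongr; exact le_abs_self _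
      _ ≤ |u - v| / m := by gcongr
  rw [abs_le]
  have h := log_sub_le v u hv hu
  rw [abs_sub_comm] at h
  exact ⟨by linarith, log_sub_le u v hu hv⟩

namespace ExpMap

variable {d : ℕ} {ε : ℝ} (S : ExpMap d ε)

theorem zero_mem_UI : (0 : ℝ) ∈ UI := ⟨le_rfl, zero_le_one⟩

theorem one_mem_UI : (1 : ℝ) ∈ UI := ⟨zero_le_one, le_rfl⟩

theorem branch_continuousOn (a : Fin d) : ContinuousOn (S.branch a) UI :=
  fun ξ hξ => (S.branch_hasDeriv a ξ hξ).continuousWithinAt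

theorem branchDeriv_continuousOn (hε : 0 < ε) (a : Fin d) :
    ContinuousOn (S.branchDeriv a) UI := by
  obtain ⟨C, -, hC⟩ := S.branchDeriv_holder a
  intro ξ hξ
  refine tendsto_iff_norm_sub_tendsto_zero.2 ?_
  have hlim : Tendsto (fun η : ℝ => C * |η - ξ| ^ ε) (𝓝[UI] ξ) (𝓝 0) := by
    have hcont : Continuous fun η : ℝ => C * |η - ξ| ^ ε :=
      continuous_const.mul
        ((continuous_id.sub continuous_const).abs.rpow_const fun _ => Or.inr hε.le)
    have := hcont.tendsto ξ
    simp only [sub_self, abs_zero, Real.zero_rpow hε.ne', mul_zero] at this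
    exact this.mono_left nhdsWithin_le_nhds
  refine squeeze_zero' (Eventually.of_forall fun _ => norm_nonneg _) ?_ hlim
  filter_upwards [self_mem_nhdsWithin] with η hη
  exact hC η hη ξ hξ

theorem exists_branchDeriv_bounds [Nonempty (Fin d)] (hε : 0 < ε) :
    ∃ m l : ℝ, 0 < m ∧ 0 < l ∧ l < 1 ∧
      ∀ a, ∀ ξ ∈ UI, m ≤ S.branchDeriv a ξ ∧ S.branchDeriv a ξ ≤ l := by
  have hne : UI.Nonempty := ⟨0, zero_mem_UI⟩
  choose u hu hmin using fun a =>
    isCompact_Icc.exists_isMinOn hne (S.branchDeriv_continuousOn hε a)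
  choose v hv hmax using fun a =>
    isCompact_Icc.exists_isMaxOn hne (S.branchDeriv_continuousOn hε a)
  obtain ⟨a, ha⟩ := Finite.exists_min fun a => S.branchDeriv a (u a)
  obtain ⟨b, hb⟩ := Finite.exists_max fun a => S.branchDeriv a (v a)
  exact ⟨_, _, (S.branchDeriv_mem a _ (hu a)).1, (S.branchDeriv_mem b _ (hv b)).1,
    (S.branchDeriv_mem b _ (hv b)).2,
    fun c ξ hξ => ⟨(ha c).trans (hmin c hξ), le_trans (hmax c hξ) (hb c)⟩⟩

theorem exists_branchDeriv_holder_const [Nonempty (Fin d)] :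
    ∃ C : ℝ, 0 < C ∧ ∀ a, ∀ ξ ∈ UI, ∀ η ∈ UI,
      |S.branchDeriv a ξ - S.branchDeriv a η| ≤ C * |ξ - η| ^ ε := by
  choose C hC0 hC using S.branchDeriv_holder
  obtain ⟨a, ha⟩ := Finite.exists_max C
  refine ⟨C a, hC0 a, fun b ξ hξ η hη => (hC b ξ hξ η hη).trans ?_⟩
  gcongr
  exact ha b

theorem exists_branch_sub_eq (a : Fin d) {u v : ℝ} (hu : u ∈ UI) (hv : v ∈ UI) (huv : u < v) :
    ∃ c ∈ Icc u v, S.branch a v - S.branch a u = S.branchDeriv a c * (v - u) := by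
  have hsub : Icc u v ⊆ UI := Icc_subset_Icc hu.1 hv.2
  obtain ⟨c, hc, hceq⟩ := exists_hasDerivAt_eq_slope (S.branch a) (S.branchDeriv a) huv
    ((S.branch_continuousOn a).mono hsub) fun z hz =>
      (S.branch_hasDeriv a z (hsub (Ioo_subset_Icc_self hz))).hasDerivAt
        (Icc_mem_nhds (hu.1.trans_lt hz.1) (hz.2.trans_le hv.2))
  refine ⟨c, Ioo_subset_Icc_self hc, ?_⟩
  rw [hceq, div_mul_cancel₀ _ (sub_pos.2 huv).ne']

theorem wordMap_mapsTo (n : ℕ) (x : ℕ → Fin d) : MapsTo (wordMap S x n) UI UI := by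
  induction n generalizing x with
  | zero => exact fun ξ hξ => hξ
  | succ n ih => exact fun ξ hξ => S.branch_maps_to _ (ih _ hξ)

theorem wordMap_strictMonoOn (n : ℕ) (x : ℕ → Fin d) : StrictMonoOn (wordMap S x n) UI := by
  induction n generalizing x with
  | zero => exact fun _ _ _ _ h => h
  | succ n ih =>
    exact fun u hu v hv h =>
      S.branch_mono _ (S.wordMap_mapsTo n _ hu) (S.wordMap_mapsTo n _ hv) (ih _ hu hv h)

theorem approx_succ (x : ℕ → Fin d) (n : ℕ) :
    approx S x (n + 1) = S.branch (x 0) (approx S (shift x) n) := by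
  simp [approx, List.range_succ_eq_map, List.foldr_map, shift]

theorem approx_mem (n : ℕ) (x : ℕ → Fin d) : approx S x n ∈ UI := by
  induction n generalizing x with
  | zero => exact zero_mem_UI
  | succ n ih => rw [approx_succ]; exact S.branch_maps_to _ (ih _)

theorem approx_le_succ (n : ℕ) (x : ℕ → Fin d) : approx S x n ≤ approx S x (n + 1) := by
  induction n generalizing x with
  | zero => exact (S.approx_mem 1 x).1
  | succ n ih =>
    rw [approx_succ, approx_succ S x (n + 1)]
    exact (S.branch_mono _).monotoneOn (S.approx_mem _ _) (S.approx_mem _ _) (ih _)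

theorem tendsto_approx (x : ℕ → Fin d) : Tendsto (approx S x) atTop (𝓝 (proj S x)) :=
  tendsto_atTop_ciSup (monotone_nat_of_le_succ fun n => S.approx_le_succ n x)
    ⟨1, by rintro _ ⟨n, rfl⟩; exact (S.approx_mem n x).2⟩

theorem proj_mem (x : ℕ → Fin d) : proj S x ∈ UI :=
  isClosed_Icc.mem_of_tendsto (S.tendsto_approx x)
    (Eventually.of_forall fun n => S.approx_mem n x)

theorem proj_eq (x : ℕ → Fin d) : proj S x = S.branch (x 0) (proj S (shift x)) := by
  have hshift : Tendsto (fun n => approx S x (n + 1)) atTop (𝓝 (proj S x)) :=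
    (tendsto_add_atTop_iff_nat 1).2 (S.tendsto_approx x)
  simp only [approx_succ] at hshift
  refine tendsto_nhds_unique hshift ?_
  exact (S.branch_continuousOn (x 0) _ (S.proj_mem _)).tendsto.comp
    (tendsto_nhdsWithin_iff.2 ⟨S.tendsto_approx _, Eventually.of_forall fun n => S.approx_mem n _⟩)

theorem proj_mem_cylinder (n : ℕ) (x : ℕ → Fin d) :
    proj S x ∈ Icc (wordMap S x n 0) (wordMap S x n 1) := by
  induction n generalizing x with
  | zero => exact S.proj_mem x
  | succ n ih =>
    rw [proj_eq]
    exact ⟨(S.branch_mono _).monotoneOn (S.wordMap_mapsTo n _ zero_mem_UI) (S.proj_mem _) (ih _).1,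
      (S.branch_mono _).monotoneOn (S.proj_mem _) (S.wordMap_mapsTo n _ one_mem_UI) (ih _).2⟩

theorem cylinder_length_pos (n : ℕ) (x : ℕ → Fin d) :
    0 < wordMap S x n 1 - wordMap S x n 0 :=
  sub_pos.2 (S.wordMap_strictMonoOn n x zero_mem_UI one_mem_UI zero_lt_one)

theorem exists_cylinder_length_succ (n : ℕ) (x : ℕ → Fin d) :
    ∃ c ∈ UI, |c - proj S (shift x)| ≤ wordMap S (shift x) n 1 - wordMap S (shift x) n 0 ∧
      wordMap S x (n + 1) 1 - wordMap S x (n + 1) 0 =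
        S.branchDeriv (x 0) c * (wordMap S (shift x) n 1 - wordMap S (shift x) n 0) := by
  have h0 := S.wordMap_mapsTo n (shift x) zero_mem_UI
  have h1 := S.wordMap_mapsTo n (shift x) one_mem_UI
  obtain ⟨c, hc, hceq⟩ :=
    S.exists_branch_sub_eq (x 0) h0 h1 (sub_pos.1 (S.cylinder_length_pos n (shift x)))
  have hp := S.proj_mem_cylinder n (shift x)
  exact ⟨c, ⟨h0.1.trans hc.1, hc.2.trans h1.2⟩,
    abs_le.2 ⟨by linarith [hc.1, hp.2], by linarith [hc.2, hp.1]⟩, hceq⟩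

theorem cylinder_length_le {l : ℝ} (hl : ∀ a, ∀ ξ ∈ UI, S.branchDeriv a ξ ≤ l) (hl0 : 0 < l)
    (n : ℕ) (x : ℕ → Fin d) : wordMap S x n 1 - wordMap S x n 0 ≤ l ^ n := by
  induction n generalizing x with
  | zero => simp [wordMap]
  | succ n ih =>
    obtain ⟨c, hc, -, heq⟩ := S.exists_cylinder_length_succ n x
    rw [heq, pow_succ']
    exact mul_le_mul (hl _ _ hc) (ih _) (S.cylinder_length_pos n _).le hl0.le

/-- Bounded distortion: cylinder lengths are comparable to exponentials of Birkhoff sums. -/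
theorem exists_distortion [Nonempty (Fin d)] (hε : 0 < ε) :
    ∃ B : ℝ, 0 ≤ B ∧ ∀ n x,
      |Real.log (wordMap S x n 1 - wordMap S x n 0) - birk (pot S) n x| ≤ B := by
  obtain ⟨m, l, hm, hl0, hl1, hml⟩ := S.exists_branchDeriv_bounds hε
  obtain ⟨C, hC0, hC⟩ := S.exists_branchDeriv_holder_const
  have hq0 : 0 < l ^ ε := Real.rpow_pos_of_pos hl0 ε
  have hq1 : l ^ ε < 1 := Real.rpow_lt_one hl0.le hl1 hε
  have hsum : ∀ n x, |Real.log (wordMap S x n 1 - wordMap S x n 0) - birk (pot S) n x| ≤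
      C / m * ∑ k ∈ Finset.range n, (l ^ ε) ^ k := by
    intro n
    induction n with
    | zero => simp [wordMap, birk]
    | succ n ih =>
      intro x
      obtain ⟨c, hc, hcp, heq⟩ := S.exists_cylinder_length_succ n x
      have hp := S.proj_mem (shift x)
      rw [heq, birk_succ, Finset.sum_range_succ, mul_add,
        Real.log_mul (S.branchDeriv_mem _ _ hc).1.ne' (S.cylinder_length_pos n _).ne']
      have hone : |Real.log (S.branchDeriv (x 0) c) - pot S x| ≤ C / m * (l ^ ε) ^ n := by
        calc |Real.log (S.branchDeriv (x 0) c) - pot S x|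
            ≤ |S.branchDeriv (x 0) c - S.branchDeriv (x 0) (proj S (shift x))| / m :=
              abs_log_sub_log_le_s15 hm (hml _ _ hc).1 (hml _ _ hp).1
          _ ≤ C * |c - proj S (shift x)| ^ ε / m := by gcongr; exact hC _ _ hc _ hp
          _ ≤ C * (l ^ n) ^ ε / m := by
              gcongr
              exact hcp.trans (S.cylinder_length_le (fun a ξ hξ => (hml a ξ hξ).2) hl0 n _)
          _ = C / m * (l ^ ε) ^ n := by
              rw [← Real.rpow_natCast, ← Real.rpow_natCast, ← Real.rpow_mul hl0.le,
                ← Real.rpow_mul hl0.le, mul_comm ε]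
              ring
      have hrest := ih (shift x)
      rw [abs_le] at hone hrest ⊢
      constructor <;> linarith
  refine ⟨C / m * (1 - l ^ ε)⁻¹, mul_nonneg (by positivity) (inv_nonneg.2 (by linarith)),
    fun n x => (hsum n x).trans ?_⟩
  gcongr
  rw [← tsum_geometric_of_lt_one hq0.le hq1]
  exact (summable_geometric_of_lt_one hq0.le hq1).sum_le_tsum _ fun _ _ => by positivity

theorem exists_branch_eq {y : ℝ} (hy : y ∈ UI) : ∃ a, ∃ ξ ∈ UI, S.branch a ξ = y := by
  simpa using S.cover hy

/-- Every point other than `1` lies in a half-open level-one cylinder. -/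
theorem exists_branch_eq_of_lt {y : ℝ} (hy : y ∈ UI) (hy1 : y < 1) :
    ∃ a, ∃ ξ ∈ Ico (0 : ℝ) 1, S.branch a ξ = y := by
  obtain ⟨a, ξ, hξ, rfl⟩ := S.exists_branch_eq hy
  rcases hξ.2.lt_or_eq with h | rfl
  · exact ⟨a, ξ, ⟨hξ.1, h⟩, rfl⟩
  have hle : ∀ b ≤ a, ∀ ζ ∈ UI, S.branch b ζ ≤ S.branch a 1 := by
    intro b hb ζ hζ
    rcases hb.lt_or_eq with hb | rfl
    · exact S.ordered b a hb ζ hζ 1 one_mem_UI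
    · exact (S.branch_mono b).monotoneOn hζ one_mem_UI hζ.2
  have hlast : (a : ℕ) + 1 < d := by
    by_contra hd
    obtain ⟨b, ζ, hζ, hb⟩ := S.exists_branch_eq one_mem_UI
    have := hle b (by rw [Fin.le_def]; omega) ζ hζ
    linarith
  set c : Fin d := ⟨a + 1, hlast⟩ with hc
  have hac : a < c := by simp [Fin.lt_def, hc]
  refine ⟨c, 0, ⟨le_rfl, zero_lt_one⟩, le_antisymm ?_ (S.ordered a c hac 1 one_mem_UI 0 zero_mem_UI)⟩
  by_contra! hgap
  have hc0 := S.branch_maps_to c zero_mem_UI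
  obtain ⟨b, ζ, hζ, hb⟩ := S.exists_branch_eq (y := (S.branch a 1 + S.branch c 0) / 2)
    ⟨by linarith [hy.1, hc0.1], by linarith [hc0.2]⟩
  rcases le_or_gt b a with hba | hba
  · linarith [hle b hba ζ hζ]
  · have hcb : c ≤ b := by
      rw [Fin.lt_def] at hba
      simp only [Fin.le_def, hc]
      omega
    have : S.branch c 0 ≤ S.branch b ζ := by
      rcases hcb.lt_or_eq with h | h
      · exact S.ordered c b h 0 zero_mem_UI ζ hζ
      · rw [h]
        exact (S.branch_mono b).monotoneOn zero_mem_UI hζ hζ.1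
    linarith

theorem lt_of_branch_lt {a b : Fin d} {ξ : ℝ} (hξ : ξ ∈ UI) (h : S.branch a ξ < S.branch b ξ) :
    a < b := by
  by_contra! hba
  rcases hba.lt_or_eq with hba | rfl
  · exact absurd (S.ordered b a hba ξ hξ ξ hξ) (not_le.2 h)
  · exact lt_irrefl _ h

theorem branch_lt_of_lt {a b : Fin d} (hab : a < b) {ξ : ℝ} (hξ : ξ ∈ Ico (0 : ℝ) 1) :
    S.branch a ξ < S.branch b ξ := by
  have hmem : ξ ∈ UI := Ico_subset_Icc_self hξ
  exact (S.branch_mono a hmem one_mem_UI hξ.2).trans_le (S.ordered a b hab 1 one_mem_UI ξ hmem)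

theorem exists_coding [Nonempty (Fin d)] {y : ℝ} (hy : y ∈ UI) :
    ∃ x : ℕ → Fin d, ∀ n, y ∈ Icc (wordMap S x n 0) (wordMap S x n 1) := by
  choose! a g hg hag using fun y (hy : y ∈ UI) => S.exists_branch_eq hy
  refine ⟨fun k => a (g^[k] y), fun n => ?_⟩
  induction n generalizing y with
  | zero => exact hy
  | succ n ih =>
    have hstep := ih (hg y hy)
    have hshift : shift (fun k => a (g^[k] y)) = fun k => a (g^[k] (g y)) := by
      funext k
      simp [shift]
    rw [← hshift] at hstep
    have hlower :=
      (S.branch_mono (a y)).monotoneOn (S.wordMap_mapsTo n _ zero_mem_UI) (hg y hy) hstep.1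
    have hupper :=
      (S.branch_mono (a y)).monotoneOn (hg y hy) (S.wordMap_mapsTo n _ one_mem_UI) hstep.2
    rw [hag y hy] at hlower hupper
    exact ⟨hlower, hupper⟩

end ExpMap

namespace IsConjugacy

open ExpMap

variable {d : ℕ} {ε : ℝ} {S T : ExpMap d ε} {Θ : ℝ → ℝ}

theorem mapsTo (hΘ : IsConjugacy S T Θ) : MapsTo Θ UI UI :=
  fun _ hξ => hΘ.2.2.1 ▸ mem_image_of_mem Θ hξ

theorem map_zero (hΘ : IsConjugacy S T Θ) : Θ 0 = 0 := by
  obtain ⟨z, hz, hz0⟩ : (0 : ℝ) ∈ Θ '' UI := hΘ.2.2.1.symm ▸ zero_mem_UI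
  exact le_antisymm ((hΘ.1.monotoneOn zero_mem_UI hz hz.1).trans hz0.le) (hΘ.mapsTo zero_mem_UI).1

theorem map_one (hΘ : IsConjugacy S T Θ) : Θ 1 = 1 := by
  obtain ⟨z, hz, hz1⟩ : (1 : ℝ) ∈ Θ '' UI := hΘ.2.2.1.symm ▸ one_mem_UI
  exact le_antisymm (hΘ.mapsTo one_mem_UI).2 (hz1.ge.trans (hΘ.1.monotoneOn hz one_mem_UI hz.2))

theorem map_branch_of_lt (hΘ : IsConjugacy S T Θ) (a : Fin d) {ξ : ℝ} (hξ : ξ ∈ Ico (0 : ℝ) 1) :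
    Θ (S.branch a ξ) = T.branch a (Θ ξ) := by
  have hmem : ξ ∈ UI := Ico_subset_Icc_self hξ
  have hΘξ : Θ ξ ∈ UI := hΘ.mapsTo hmem
  have hexists : ∀ a, ∃ b, Θ (S.branch a ξ) = T.branch b (Θ ξ) := by
    intro a
    have hS := S.branch_maps_to a hmem
    have hlt : S.branch a ξ < 1 :=
      (S.branch_mono a hmem one_mem_UI hξ.2).trans_le (S.branch_maps_to a one_mem_UI).2
    obtain ⟨b, ζ, hζ, hb⟩ := T.exists_branch_eq_of_lt (hΘ.mapsTo hS)
      (hΘ.map_one ▸ hΘ.1 hS one_mem_UI hlt)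
    refine ⟨b, ?_⟩
    have hconj := hΘ.2.2.2 _ hS
    rw [S.right_inv a ξ hξ, ← hb, T.right_inv b ζ hζ] at hconj
    rw [← hb, hconj]
  choose b hb using hexists
  have hmono : StrictMono b := by
    intro a a' haa'
    refine T.lt_of_branch_lt hΘξ ?_
    rw [← hb, ← hb]
    exact hΘ.1 (S.branch_maps_to a hmem) (S.branch_maps_to a' hmem) (S.branch_lt_of_lt haa' hξ)
  rw [hb a, le_antisymm (hmono.le_id a) (hmono.id_le a), id]

theorem map_branch (hΘ : IsConjugacy S T Θ) (a : Fin d) {ξ : ℝ} (hξ : ξ ∈ UI) :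
    Θ (S.branch a ξ) = T.branch a (Θ ξ) := by
  have hclosure : closure (Ico (0 : ℝ) 1) = UI := closure_Ico zero_ne_one
  have heq : EqOn (fun ξ => Θ (S.branch a ξ)) (fun ξ => T.branch a (Θ ξ)) (Ico 0 1) :=
    fun ξ hξ => hΘ.map_branch_of_lt a hξ
  exact heq.of_subset_closure (hΘ.2.1.comp (S.branch_continuousOn a) (S.branch_maps_to a))
    ((T.branch_continuousOn a).comp hΘ.2.1 hΘ.mapsTo) Ico_subset_Icc_self hclosure.ge hξ

theorem map_wordMap (hΘ : IsConjugacy S T Θ) (n : ℕ) (x : ℕ → Fin d) {ξ : ℝ} (hξ : ξ ∈ UI) :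
    Θ (wordMap S x n ξ) = wordMap T x n (Θ ξ) := by
  induction n generalizing x with
  | zero => rfl
  | succ n ih =>
    simp only [wordMap]
    rw [hΘ.map_branch _ (S.wordMap_mapsTo n _ hξ), ih]

end IsConjugacy

namespace ExpMap

variable {d : ℕ} {ε : ℝ} (S : ExpMap d ε)

/-- An interval of length `s` contains a cylinder whose Birkhoff sum has exponential at least of
order `s`. -/
theorem exists_cylinder_subset [Nonempty (Fin d)] (hε : 0 < ε) :
    ∃ C : ℝ, 0 < C ∧ ∀ u ∈ UI, ∀ v ∈ UI, u < v → ∃ x : ℕ → Fin d, ∃ n : ℕ, 1 ≤ n ∧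
      u ≤ wordMap S x n 0 ∧ wordMap S x n 1 ≤ v ∧
      v - u ≤ C * Real.exp (birk (pot S) n x) := by
  obtain ⟨m, l, hm, hl0, hl1, hml⟩ := S.exists_branchDeriv_bounds hε
  obtain ⟨B, hB0, hB⟩ := S.exists_distortion hε
  have hstep : ∀ n x, Real.exp (birk (pot S) n x) * m ≤ Real.exp (birk (pot S) (n + 1) x) := by
    intro n
    induction n with
    | zero =>
      intro x
      have hp := S.proj_mem (shift x)
      rw [birk_succ]
      simp only [birk, pot, Finset.range_zero, Finset.sum_empty, Real.exp_zero, one_mul, add_zero]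
      rw [Real.exp_log (S.branchDeriv_mem _ _ hp).1]
      exact (hml _ _ hp).1
    | succ n ih =>
      intro x
      rw [birk_succ _ n, birk_succ _ (n + 1), Real.exp_add, Real.exp_add, mul_assoc]
      gcongr
      exact ih _
  refine ⟨2 * Real.exp B / m, by positivity, fun u hu v hv huv => ?_⟩
  obtain ⟨x, hx⟩ := S.exists_coding (y := (u + v) / 2)
    ⟨by linarith [hu.1, hv.1], by linarith [hu.2, hv.2]⟩
  have hlog : ∀ n, wordMap S x n 1 - wordMap S x n 0 ≤
      Real.exp B * Real.exp (birk (pot S) n x) ∧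
      Real.exp (birk (pot S) n x) ≤ Real.exp B * (wordMap S x n 1 - wordMap S x n 0) := by
    intro n
    have h := abs_le.1 (hB n x)
    have hpos := S.cylinder_length_pos n x
    constructor
    · rw [← Real.exp_add, ← Real.log_le_iff_le_exp hpos]
      linarith
    · rw [← Real.exp_log hpos, ← Real.exp_add]
      exact Real.exp_le_exp.2 (by linarith)
  have hsmall : ∃ n, Real.exp B * Real.exp (birk (pot S) n x) ≤ (v - u) / 2 := by
    obtain ⟨n, hn⟩ := exists_pow_lt_of_lt_one
      (show 0 < (v - u) / 2 / (Real.exp B * Real.exp B) by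
        have := sub_pos.2 huv
        positivity) hl1
    refine ⟨n, ?_⟩
    rw [lt_div_iff₀ (by positivity)] at hn
    have hlen := S.cylinder_length_le (fun a ξ hξ => (hml a ξ hξ).2) hl0 n x
    calc Real.exp B * Real.exp (birk (pot S) n x)
        ≤ Real.exp B * (Real.exp B * l ^ n) := by
          gcongr
          exact (hlog n).2.trans (by gcongr)
      _ ≤ (v - u) / 2 := by linarith
  classical
  have hfind := Nat.find_spec hsmall
  have hmin : ∀ k < Nat.find hsmall, (v - u) / 2 < Real.exp B * Real.exp (birk (pot S) k x) :=
    fun k hk => not_le.1 (Nat.find_min hsmall hk)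
  generalize Nat.find hsmall = n at hfind hmin
  obtain ⟨k, rfl⟩ : ∃ k, n = k + 1 := by
    refine Nat.exists_eq_add_one.2 (Nat.pos_of_ne_zero ?_)
    rintro rfl
    simp only [birk, Finset.range_zero, Finset.sum_empty, Real.exp_zero, mul_one] at hfind
    have := Real.one_le_exp hB0
    linarith [hu.1, hv.2]
  have hlen := (hlog (k + 1)).1.trans hfind
  have hmid := hx (k + 1)
  refine ⟨x, k + 1, by omega, by linarith [hmid.2], by linarith [hmid.1], ?_⟩
  have hk := hmin k (Nat.lt_succ_self k)
  rw [div_mul_eq_mul_div, le_div_iff₀ hm]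
  calc (v - u) * m ≤ 2 * (Real.exp B * Real.exp (birk (pot S) k x)) * m := by
        gcongr
        linarith
    _ = 2 * Real.exp B * (Real.exp (birk (pot S) k x) * m) := by ring
    _ ≤ 2 * Real.exp B * Real.exp (birk (pot S) (k + 1) x) := by
        gcongr
        exact hstep k x

end ExpMap

/-- If there is `ρ ≥ 1` with `S_nψ(x) ≤ ρ⁻¹·S_nφ(x)` for all `x ∈ Σ`
and `n ≥ 1`, then `Θ` is Hölder continuous with exponent `1/ρ`. -/
theorem statement_15 {d : ℕ} {ε : ℝ} (hd : 2 ≤ d) (hε : 0 < ε)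
    (S T : ExpMap d ε) (Θ : ℝ → ℝ) (hΘ : IsConjugacy S T Θ)
    (ρ : ℝ) (hρ : 1 ≤ ρ)
    (h : ∀ x : ℕ → Fin d, ∀ n : ℕ, 1 ≤ n → birk (pot T) n x ≤ ρ⁻¹ * birk (pot S) n x) :
    ∃ C : ℝ, 0 < C ∧ ∀ ξ ∈ UI, ∀ η ∈ UI, |Θ ξ - Θ η| ≤ C * |ξ - η| ^ (1 / ρ) := by
  have : Nonempty (Fin d) := ⟨⟨0, by omega⟩⟩
  obtain ⟨C, hC0, hC⟩ := T.exists_cylinder_subset hε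
  obtain ⟨B, -, hB⟩ := S.exists_distortion hε
  have hρ0 : 0 < ρ := by linarith
  have hlt : ∀ ξ ∈ UI, ∀ η ∈ UI, ξ < η →
      |Θ ξ - Θ η| ≤ C * Real.exp B ^ (1 / ρ) * |ξ - η| ^ (1 / ρ) := by
    intro ξ hξ η hη hξη
    have hΘlt := hΘ.1 hξ hη hξη
    obtain ⟨x, n, hn, hleft, hright, hbound⟩ :=
      hC _ (hΘ.mapsTo hξ) _ (hΘ.mapsTo hη) hΘlt
    have h0 := hΘ.map_wordMap n x ExpMap.zero_mem_UI
    have h1 := hΘ.map_wordMap n x ExpMap.one_mem_UI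
    rw [hΘ.map_zero] at h0
    rw [hΘ.map_one] at h1
    rw [← h0, hΘ.1.le_iff_le hξ (S.wordMap_mapsTo n x ExpMap.zero_mem_UI)] at hleft
    rw [← h1, hΘ.1.le_iff_le (S.wordMap_mapsTo n x ExpMap.one_mem_UI) hη] at hright
    have hlen : Real.exp (birk (pot S) n x) ≤ Real.exp B * (η - ξ) := by
      have hd := abs_le.1 (hB n x)
      calc Real.exp (birk (pot S) n x)
          ≤ Real.exp (B + Real.log (wordMap S x n 1 - wordMap S x n 0)) :=
            Real.exp_le_exp.2 (by linarith)
        _ = Real.exp B * (wordMap S x n 1 - wordMap S x n 0) := by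
            rw [Real.exp_add, Real.exp_log (S.cylinder_length_pos n x)]
        _ ≤ Real.exp B * (η - ξ) := by gcongr
    rw [abs_sub_comm, abs_of_pos (sub_pos.2 hΘlt), abs_sub_comm, abs_of_pos (sub_pos.2 hξη),
      mul_assoc, ← Real.mul_rpow (Real.exp_pos B).le (sub_pos.2 hξη).le]
    calc Θ η - Θ ξ ≤ C * Real.exp (birk (pot T) n x) := hbound
      _ ≤ C * Real.exp (ρ⁻¹ * birk (pot S) n x) := by
          gcongr
          exact h x n hn
      _ = C * Real.exp (birk (pot S) n x) ^ (1 / ρ) := by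
          rw [← Real.exp_mul, one_div, mul_comm ρ⁻¹]
      _ ≤ C * (Real.exp B * (η - ξ)) ^ (1 / ρ) := by gcongr
  refine ⟨C * Real.exp B ^ (1 / ρ), by positivity, fun ξ hξ η hη => ?_⟩
  rcases lt_trichotomy ξ η with hξη | rfl | hξη
  · exact hlt ξ hξ η hη hξη
  · simp only [sub_self, abs_zero]
    positivity
  · rw [abs_sub_comm (Θ ξ), abs_sub_comm ξ]
    exact hlt η hη ξ hξ hξη
end
end

section
/- Let S and T be two expanding piecewise C^{1+ε} maps of 𝒰 with the same number d of branches. Then there exists exactly one increasing homeomorphism Θ : 𝒰 → 𝒰 satisfying T∘Θ = Θ∘S, and this Θ is Hölder continuous: there exist α ∈ (0,1] and C > 0 such that |Θ(ξ) − Θ(η)| ≤ C·|ξ − η|^α for all ξ, η ∈ 𝒰. -/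
open Set Filter Topology

noncomputable section

section Branches

lemma continuousOn_of_holder {Θ : ℝ → ℝ} {s : Set ℝ} {α C : ℝ} (hα : 0 < α)
    (h : ∀ ξ ∈ s, ∀ η ∈ s, |Θ ξ - Θ η| ≤ C * |ξ - η| ^ α) : ContinuousOn Θ s := by
  intro x hx
  have h0 : Tendsto (fun y : ℝ => C * |y - x| ^ α) (𝓝[s] x) (𝓝 0) := by
    have : Continuous fun y : ℝ => C * |y - x| ^ α :=
      continuous_const.mul ((continuous_id.sub continuous_const).abs.rpow_const
        fun _ => Or.inr hα.le)
    have h := this.tendsto x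
    simp only [sub_self, abs_zero, Real.zero_rpow hα.ne', mul_zero] at h
    exact h.mono_left nhdsWithin_le_nhds
  rw [ContinuousWithinAt, tendsto_iff_dist_tendsto_zero]
  refine squeeze_zero' (Eventually.of_forall fun _ => dist_nonneg) ?_ h0
  filter_upwards [self_mem_nhdsWithin] with y hy
  exact h y hy x hx

variable {d : ℕ} {ε : ℝ} (S : ExpMap d ε)

lemma zero_mem_UI : (0 : ℝ) ∈ UI := ⟨le_rfl, zero_le_one⟩

lemma one_mem_UI : (1 : ℝ) ∈ UI := ⟨zero_le_one, le_rfl⟩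

lemma abs_sub_le_one_of_mem_UI {x y : ℝ} (hx : x ∈ UI) (hy : y ∈ UI) : |x - y| ≤ 1 := by
  rw [abs_le]
  constructor <;> linarith [hx.1, hx.2, hy.1, hy.2]

lemma ExpMap.exists_eq_branch {x : ℝ} (hx : x ∈ UI) : ∃ a, ∃ ξ ∈ UI, S.branch a ξ = x := by
  obtain ⟨a, ξ, hξ, h⟩ := mem_iUnion.1 (S.cover hx)
  exact ⟨a, ξ, hξ, h⟩

lemma ExpMap.nonempty (S : ExpMap d ε) : Nonempty (Fin d) :=
  ⟨(S.exists_eq_branch zero_mem_UI).choose⟩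

lemma ExpMap.branchDeriv_continuousOn_s19 (hε : 0 < ε) (a : Fin d) :
    ContinuousOn (S.branchDeriv a) UI := by
  obtain ⟨C, -, hC⟩ := S.branchDeriv_holder a
  exact continuousOn_of_holder hε hC

/-- Uniform two-sided bounds on the slopes of the inverse branches. -/
lemma ExpMap.exists_slope_bounds (hε : 0 < ε) :
    ∃ m r : ℝ, 0 < m ∧ m < 1 ∧ 0 < r ∧ r < 1 ∧ ∀ a, ∀ ξ ∈ UI, ∀ η ∈ UI,
      m * |ξ - η| ≤ |S.branch a ξ - S.branch a η| ∧
      |S.branch a ξ - S.branch a η| ≤ r * |ξ - η| := by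
  have := S.nonempty
  have hne : UI.Nonempty := ⟨0, zero_mem_UI⟩
  have hmin : ∀ a, ∃ p ∈ UI, ∀ x ∈ UI, S.branchDeriv a p ≤ S.branchDeriv a x := fun a =>
    isCompact_Icc.exists_isMinOn hne (S.branchDeriv_continuousOn_s19 hε a)
  have hmax : ∀ a, ∃ p ∈ UI, ∀ x ∈ UI, S.branchDeriv a x ≤ S.branchDeriv a p := fun a =>
    isCompact_Icc.exists_isMaxOn hne (S.branchDeriv_continuousOn_s19 hε a)
  choose p hp hpmin using hmin
  choose q hq hqmax using hmax
  obtain ⟨a₀, ha₀⟩ := Finite.exists_min fun a => S.branchDeriv a (p a)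
  obtain ⟨a₁, ha₁⟩ := Finite.exists_max fun a => S.branchDeriv a (q a)
  refine ⟨S.branchDeriv a₀ (p a₀), S.branchDeriv a₁ (q a₁), (S.branchDeriv_mem _ _ (hp _)).1,
    (S.branchDeriv_mem _ _ (hp _)).2, (S.branchDeriv_mem _ _ (hq _)).1,
    (S.branchDeriv_mem _ _ (hq _)).2, fun a => ?_⟩
  have key : ∀ ξ ∈ UI, ∀ η ∈ UI, ξ < η →
      S.branchDeriv a₀ (p a₀) * (η - ξ) ≤ S.branch a η - S.branch a ξ ∧
      S.branch a η - S.branch a ξ ≤ S.branchDeriv a₁ (q a₁) * (η - ξ) := by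
    intro ξ hξ η hη h
    have hsub : Icc ξ η ⊆ UI := Icc_subset_Icc hξ.1 hη.2
    obtain ⟨c, hc, hslope⟩ := exists_hasDerivAt_eq_slope (S.branch a) (S.branchDeriv a) h
      (fun x hx => (S.branch_hasDeriv a x (hsub hx)).continuousWithinAt.mono hsub)
      (fun x hx => (S.branch_hasDeriv a x (hsub (Ioo_subset_Icc_self hx))).hasDerivAt
        (Icc_mem_nhds (hξ.1.trans_lt hx.1) (hx.2.trans_le hη.2)))
    have hcU := hsub (Ioo_subset_Icc_self hc)
    have hpos : 0 < η - ξ := sub_pos.2 h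
    rw [eq_div_iff hpos.ne'] at hslope
    rw [← hslope]
    exact ⟨mul_le_mul_of_nonneg_right ((ha₀ a).trans (hpmin a c hcU)) hpos.le,
      mul_le_mul_of_nonneg_right ((hqmax a c hcU).trans (ha₁ a)) hpos.le⟩
  intro ξ hξ η hη
  rcases lt_trichotomy ξ η with h | rfl | h
  · have := S.branch_mono a hξ hη h
    rw [abs_sub_comm, abs_sub_comm (S.branch a ξ), abs_of_pos (sub_pos.2 h),
      abs_of_pos (sub_pos.2 this)]
    exact key ξ hξ η hη h
  · simp
  · have := S.branch_mono a hη hξ h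
    rw [abs_of_pos (sub_pos.2 h), abs_of_pos (sub_pos.2 this)]
    exact key η hη ξ hξ h

lemma ExpMap.branch_continuousOn_s19 (a : Fin d) : ContinuousOn (S.branch a) UI :=
  fun x hx => (S.branch_hasDeriv a x hx).continuousWithinAt

lemma ExpMap.branch_zero_lt_one (a : Fin d) : S.branch a 0 < S.branch a 1 :=
  S.branch_mono a zero_mem_UI one_mem_UI zero_lt_one

lemma ExpMap.branch_zero_le (a : Fin d) {ξ : ℝ} (hξ : ξ ∈ UI) : S.branch a 0 ≤ S.branch a ξ :=
  (S.branch_mono a).monotoneOn zero_mem_UI hξ hξ.1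

lemma ExpMap.branch_le_one (a : Fin d) {ξ : ℝ} (hξ : ξ ∈ UI) : S.branch a ξ ≤ S.branch a 1 :=
  (S.branch_mono a).monotoneOn hξ one_mem_UI hξ.2

lemma ExpMap.branch_one_le_branch_zero {a b : Fin d} (h : a < b) :
    S.branch a 1 ≤ S.branch b 0 :=
  S.ordered a b h 1 one_mem_UI 0 zero_mem_UI

lemma ExpMap.branch_first {a : Fin d} (ha : ∀ c, a ≤ c) : S.branch a 0 = 0 := by
  obtain ⟨c, ξ, hξ, h⟩ := S.exists_eq_branch zero_mem_UI
  have h0 := (S.branch_maps_to a zero_mem_UI).1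
  refine le_antisymm ?_ h0
  conv_rhs => rw [← h]
  rcases (ha c).eq_or_lt with rfl | hac
  · exact S.branch_zero_le _ hξ
  · exact S.ordered a c hac 0 zero_mem_UI ξ hξ

lemma ExpMap.branch_last {a : Fin d} (ha : ∀ c, c ≤ a) : S.branch a 1 = 1 := by
  obtain ⟨c, ξ, hξ, h⟩ := S.exists_eq_branch one_mem_UI
  have h0 := (S.branch_maps_to a one_mem_UI).2
  refine le_antisymm h0 ?_
  conv_lhs => rw [← h]
  rcases (ha c).eq_or_lt with rfl | hac
  · exact S.branch_le_one _ hξ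
  · exact S.ordered c a hac ξ hξ 1 one_mem_UI

lemma ExpMap.branch_succ {a b : Fin d} (hab : (b : ℕ) = a + 1) :
    S.branch a 1 = S.branch b 0 := by
  have hlt : a < b := by rw [Fin.lt_def]; omega
  refine le_antisymm (S.branch_one_le_branch_zero hlt) (not_lt.1 fun h => ?_)
  have ha := S.branch_maps_to a one_mem_UI
  have hb := S.branch_maps_to b zero_mem_UI
  obtain ⟨c, ξ, hξ, hc⟩ := S.exists_eq_branch
    (x := (S.branch a 1 + S.branch b 0) / 2) ⟨by linarith [ha.1, hb.1], by linarith [ha.2, hb.2]⟩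
  rcases lt_or_ge c b with hcb | hbc
  · have hca : c ≤ a := by rw [Fin.lt_def] at hcb; rw [Fin.le_def]; omega
    have : S.branch c ξ ≤ S.branch a 1 := by
      rcases hca.eq_or_lt with rfl | hlt
      · exact S.branch_le_one _ hξ
      · exact S.ordered _ _ hlt _ hξ _ one_mem_UI
    linarith
  · have : S.branch b 0 ≤ S.branch c ξ := by
      rcases hbc.eq_or_lt with rfl | hlt
      · exact S.branch_zero_le _ hξ
      · exact S.ordered _ _ hlt _ zero_mem_UI _ hξ
    linarith

lemma Fin.le_all_or_exists_succ (a : Fin d) :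
    (∀ c, c ≤ a) ∨ ∃ b : Fin d, (b : ℕ) = a + 1 := by
  by_cases h : (a : ℕ) + 1 < d
  · exact Or.inr ⟨⟨a + 1, h⟩, rfl⟩
  · exact Or.inl fun c => by rw [Fin.le_def]; omega

/-- Two branches with distinct indices only meet at the common endpoint of adjacent images. -/
lemma ExpMap.eq_of_branch_eq {a b : Fin d} (hab : a < b) {ξ η : ℝ} (hξ : ξ ∈ UI) (hη : η ∈ UI)
    (h : S.branch a ξ = S.branch b η) : ξ = 1 ∧ η = 0 ∧ (b : ℕ) = a + 1 := by
  have h1 := S.branch_le_one a hξ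
  have h2 := S.branch_one_le_branch_zero hab
  have h3 := S.branch_zero_le b hη
  refine ⟨(S.branch_mono a).injOn hξ one_mem_UI (by linarith),
    (S.branch_mono b).injOn hη zero_mem_UI (by linarith), ?_⟩
  by_contra hne
  have hlt : (a : ℕ) < b := hab
  let c : Fin d := ⟨a + 1, by omega⟩
  have hac : a < c := by rw [Fin.lt_def]; simp [c]
  have hcb : c < b := by rw [Fin.lt_def]; simp only [c]; omega
  have := S.branch_one_le_branch_zero hac
  have := S.branch_one_le_branch_zero hcb
  have := S.branch_zero_lt_one c
  linarith

lemma ExpMap.exists_eq_branch_of_lt_one {x : ℝ} (hx : x ∈ Ico (0 : ℝ) 1) :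
    ∃ a, ∃ ξ ∈ Ico (0 : ℝ) 1, S.branch a ξ = x := by
  obtain ⟨a, ξ, hξ, h⟩ := S.exists_eq_branch (Ico_subset_Icc_self hx)
  rcases hξ.2.lt_or_eq with h1 | rfl
  · exact ⟨a, ξ, ⟨hξ.1, h1⟩, h⟩
  · rcases Fin.le_all_or_exists_succ a with ha | ⟨b, hb⟩
    · rw [S.branch_last ha] at h
      exact absurd hx.2 (by rw [← h]; exact lt_irrefl _)
    · exact ⟨b, 0, ⟨le_rfl, zero_lt_one⟩, by rw [← S.branch_succ hb, h]⟩

end Branches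

section Intertwining

variable {d : ℕ} {ε : ℝ} {S T R : ExpMap d ε}

/-- `Θ` maps the unit interval to itself and carries each inverse branch of `S` to the
inverse branch of `T` with the same index. -/
def Intertwines (S T : ExpMap d ε) (Θ : ℝ → ℝ) : Prop :=
  MapsTo Θ UI UI ∧ ∀ a, ∀ ξ ∈ UI, Θ (S.branch a ξ) = T.branch a (Θ ξ)

lemma intertwines_id : Intertwines S S id := ⟨mapsTo_id _, fun _ _ _ => rfl⟩

lemma Intertwines.comp {Θ Φ : ℝ → ℝ} (hΦ : Intertwines T R Φ) (hΘ : Intertwines S T Θ) :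
    Intertwines S R (Φ ∘ Θ) :=
  ⟨hΦ.1.comp hΘ.1, fun a ξ hξ => by
    simp only [Function.comp_apply]
    rw [hΘ.2 a ξ hξ, hΦ.2 a _ (hΘ.1 hξ)]⟩

lemma le_of_forall_le_add_pow {x y r : ℝ} (hr0 : 0 ≤ r) (hr : r < 1)
    (h : ∀ n : ℕ, x ≤ y + r ^ n) : x ≤ y := by
  have hlim := (tendsto_pow_atTop_nhds_zero_of_lt_one hr0 hr).const_add y
  rw [add_zero] at hlim
  exact ge_of_tendsto' hlim h

lemma Intertwines.eqOn (hε : 0 < ε) {Θ Φ : ℝ → ℝ} (hΘ : Intertwines S T Θ)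
    (hΦ : Intertwines S T Φ) : EqOn Θ Φ UI := by
  obtain ⟨m, r, -, -, hr0, hr1, hb⟩ := T.exists_slope_bounds hε
  have key : ∀ n : ℕ, ∀ x ∈ UI, |Θ x - Φ x| ≤ r ^ n := by
    intro n
    induction n with
    | zero => exact fun x hx => by simpa using abs_sub_le_one_of_mem_UI (hΘ.1 hx) (hΦ.1 hx)
    | succ n ih =>
      intro x hx
      obtain ⟨a, ξ, hξ, rfl⟩ := S.exists_eq_branch hx
      rw [hΘ.2 a ξ hξ, hΦ.2 a ξ hξ, pow_succ']
      exact ((hb a _ (hΘ.1 hξ) _ (hΦ.1 hξ)).2).trans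
        (mul_le_mul_of_nonneg_left (ih ξ hξ) hr0.le)
  intro x hx
  have : |Θ x - Φ x| ≤ 0 :=
    le_of_forall_le_add_pow hr0.le hr1 fun n => by simpa using key n x hx
  exact sub_eq_zero.1 (abs_nonpos_iff.1 this)

lemma ExpMap.eq_of_branch_eq_self (hε : 0 < ε) (a : Fin d) {x y : ℝ} (hx : x ∈ UI) (hy : y ∈ UI)
    (h1 : S.branch a x = x) (h2 : S.branch a y = y) : x = y := by
  obtain ⟨m, r, -, -, hr0, hr1, hb⟩ := S.exists_slope_bounds hε
  have h := (hb a x hx y hy).2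
  rw [h1, h2] at h
  have : |x - y| ≤ 0 := by nlinarith [abs_nonneg (x - y)]
  exact sub_eq_zero.1 (abs_nonpos_iff.1 this)

lemma exists_forall_le [Nonempty (Fin d)] : ∃ a : Fin d, ∀ c, a ≤ c :=
  Finite.exists_min (id : Fin d → Fin d)

lemma exists_forall_ge [Nonempty (Fin d)] : ∃ a : Fin d, ∀ c, c ≤ a :=
  Finite.exists_max (id : Fin d → Fin d)

lemma Intertwines.map_zero (hε : 0 < ε) {Θ : ℝ → ℝ} (hΘ : Intertwines S T Θ) : Θ 0 = 0 := by
  have := S.nonempty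
  obtain ⟨a, ha⟩ := exists_forall_le (d := d)
  refine T.eq_of_branch_eq_self hε a (hΘ.1 zero_mem_UI) zero_mem_UI ?_ (T.branch_first ha)
  rw [← hΘ.2 a 0 zero_mem_UI, S.branch_first ha]

lemma Intertwines.map_one (hε : 0 < ε) {Θ : ℝ → ℝ} (hΘ : Intertwines S T Θ) : Θ 1 = 1 := by
  have := S.nonempty
  obtain ⟨a, ha⟩ := exists_forall_ge (d := d)
  refine T.eq_of_branch_eq_self hε a (hΘ.1 one_mem_UI) one_mem_UI ?_ (T.branch_last ha)
  rw [← hΘ.2 a 1 one_mem_UI, S.branch_last ha]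

/-- An intertwining map exists: it is the fixed point of a contraction. -/
lemma exists_intertwines (hε : 0 < ε) (S T : ExpMap d ε) : ∃ Θ, Intertwines S T Θ := by
  obtain ⟨m, r, -, -, hr0, hr1, hb⟩ := T.exists_slope_bounds hε
  have hcov : ∀ x, ∃ a, ∃ ξ, x ∈ UI → ξ ∈ UI ∧ S.branch a ξ = x := fun x => by
    by_cases hx : x ∈ UI
    · obtain ⟨a, ξ, hξ, h⟩ := S.exists_eq_branch hx
      exact ⟨a, ξ, fun _ => ⟨hξ, h⟩⟩
    · exact ⟨S.nonempty.some, 0, fun h => absurd h hx⟩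
  choose a g hg using hcov
  let u : ℕ → ℝ → ℝ := fun n => (fun f x => T.branch (a x) (f (g x)))^[n] id
  have hu : ∀ n x, u (n + 1) x = T.branch (a x) (u n (g x)) := fun n x => by
    simp only [u, Function.iterate_succ_apply']
  have humem : ∀ n, ∀ x ∈ UI, u n x ∈ UI := by
    intro n
    induction n with
    | zero => exact fun x hx => hx
    | succ n ih =>
      intro x hx
      rw [hu]
      exact T.branch_maps_to _ (ih _ (hg x hx).1)
  have hdist : ∀ n, ∀ x ∈ UI, dist (u n x) (u (n + 1) x) ≤ 1 * r ^ n := by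
    intro n
    induction n with
    | zero =>
      intro x hx
      rw [pow_zero, mul_one, Real.dist_eq]
      exact abs_sub_le_one_of_mem_UI (humem 0 x hx) (humem _ x hx)
    | succ n ih =>
      intro x hx
      have hgx := (hg x hx).1
      have h := ih _ hgx
      rw [hu, hu (n + 1)]
      refine ((hb (a x) _ (humem n _ hgx) _ (humem (n + 1) _ hgx)).2).trans ?_
      rw [one_mul] at h ⊢
      rw [pow_succ']
      exact mul_le_mul_of_nonneg_left h hr0.le
  have hlim : ∀ x, ∃ l, x ∈ UI → Tendsto (fun n => u n x) atTop (𝓝 l) := fun x => by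
    by_cases hx : x ∈ UI
    · obtain ⟨l, hl⟩ := cauchySeq_tendsto_of_complete
        (cauchySeq_of_le_geometric r 1 hr1 fun n => hdist n x hx)
      exact ⟨l, fun _ => hl⟩
    · exact ⟨0, fun h => absurd h hx⟩
  choose Θ hΘ using hlim
  have hΘmem : MapsTo Θ UI UI := fun x hx =>
    isClosed_Icc.mem_of_tendsto (hΘ x hx) (Eventually.of_forall fun n => humem n x hx)
  have hfix : ∀ x ∈ UI, Θ x = T.branch (a x) (Θ (g x)) := by
    intro x hx
    have hgx := (hg x hx).1
    refine tendsto_nhds_unique ((tendsto_add_atTop_iff_nat 1).2 (hΘ x hx)) ?_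
    simp only [hu]
    refine (T.branch_continuousOn_s19 (a x) _ (hΘmem hgx)).tendsto.comp ?_
    exact tendsto_nhdsWithin_iff.2 ⟨hΘ _ hgx, Eventually.of_forall fun n => humem n _ hgx⟩
  have hzero : Θ 0 = 0 := by
    have := S.nonempty
    obtain ⟨b, hb0⟩ := exists_forall_le (d := d)
    obtain ⟨hgU, hge⟩ := hg 0 zero_mem_UI
    have hab : a 0 = b ∧ g 0 = 0 := by
      have hbr := S.branch_first hb0
      rcases (hb0 (a 0)).eq_or_lt with h | h
      · rw [← h] at hge
        exact ⟨h.symm, (S.branch_mono b).injOn hgU zero_mem_UI (by rw [hge, hbr])⟩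
      · exact absurd (S.eq_of_branch_eq h zero_mem_UI hgU (hbr.trans hge.symm)).1 zero_ne_one
    refine T.eq_of_branch_eq_self hε b (hΘmem zero_mem_UI) zero_mem_UI ?_ (T.branch_first hb0)
    conv_rhs => rw [hfix 0 zero_mem_UI, hab.1, hab.2]
  have hone : Θ 1 = 1 := by
    have := S.nonempty
    obtain ⟨b, hb1⟩ := exists_forall_ge (d := d)
    obtain ⟨hgU, hge⟩ := hg 1 one_mem_UI
    have hab : a 1 = b ∧ g 1 = 1 := by
      have hbr := S.branch_last hb1
      rcases (hb1 (a 1)).eq_or_lt with h | h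
      · rw [h] at hge
        exact ⟨h, (S.branch_mono b).injOn hgU one_mem_UI (by rw [hge, hbr])⟩
      · exact absurd (S.eq_of_branch_eq h hgU one_mem_UI (hge.trans hbr.symm)).2.1 one_ne_zero
    refine T.eq_of_branch_eq_self hε b (hΘmem one_mem_UI) one_mem_UI ?_ (T.branch_last hb1)
    conv_rhs => rw [hfix 1 one_mem_UI, hab.1, hab.2]
  refine ⟨Θ, hΘmem, fun b ξ hξ => ?_⟩
  obtain ⟨hgU, hge⟩ := hg _ (S.branch_maps_to b hξ)
  rw [hfix _ (S.branch_maps_to b hξ)]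
  generalize a (S.branch b ξ) = c at hge ⊢
  generalize g (S.branch b ξ) = η at hgU hge ⊢
  rcases lt_trichotomy c b with h | rfl | h
  · obtain ⟨rfl, rfl, hsucc⟩ := S.eq_of_branch_eq h hgU hξ hge
    rw [hzero, hone, T.branch_succ hsucc]
  · rw [(S.branch_mono c).injOn hgU hξ hge]
  · obtain ⟨rfl, rfl, hsucc⟩ := S.eq_of_branch_eq h hξ hgU hge.symm
    rw [hzero, hone, T.branch_succ hsucc]

lemma Intertwines.injOn (hε : 0 < ε) {Θ : ℝ → ℝ} (hΘ : Intertwines S T Θ) : InjOn Θ UI := by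
  obtain ⟨Φ, hΦ⟩ := exists_intertwines hε T S
  have h : EqOn (Φ ∘ Θ) id UI := (hΦ.comp hΘ).eqOn hε intertwines_id
  exact LeftInvOn.injOn (f₁' := Φ) h

lemma exists_exponent {m r : ℝ} (hm0 : 0 < m) (hm1 : m < 1) (hr0 : 0 < r) (hr1 : r < 1) :
    ∃ α ∈ Ioc (0 : ℝ) 1, r ≤ m ^ α := by
  have hm := Real.log_neg hm0 hm1
  have hr := Real.log_neg hr0 hr1
  refine ⟨min 1 (Real.log r / Real.log m),
    ⟨lt_min one_pos (div_pos_of_neg_of_neg hr hm), min_le_left _ _⟩, ?_⟩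
  rw [Real.le_rpow_iff_log_le hr0 hm0]
  have h := mul_le_mul_of_nonpos_right (min_le_right 1 (Real.log r / Real.log m)) hm.le
  rwa [div_mul_cancel₀ _ hm.ne] at h

/-- Points in the images of distinct branches are either far apart or separated by a common
endpoint. -/
lemma ExpMap.adjacent_or_far {m : ℝ} (hm : ∀ c, m ≤ S.branch c 1 - S.branch c 0)
    {a b : Fin d} (hab : a < b) {ξ η : ℝ} (hξ : ξ ∈ UI) (hη : η ∈ UI) :
    (b : ℕ) = a + 1 ∨ m ≤ S.branch b η - S.branch a ξ := by
  by_cases h : (b : ℕ) = a + 1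
  · exact Or.inl h
  · have hlt : (a : ℕ) < b := hab
    let c : Fin d := ⟨a + 1, by omega⟩
    have h1 := S.ordered a c (by rw [Fin.lt_def]; simp [c]) ξ hξ 0 zero_mem_UI
    have h2 := S.ordered c b (by rw [Fin.lt_def]; simp only [c]; omega) 1 one_mem_UI η hη
    have h3 := hm c
    exact Or.inr (by linarith)

lemma Intertwines.holder (hε : 0 < ε) {Θ : ℝ → ℝ} (hΘ : Intertwines S T Θ) :
    ∃ α : ℝ, α ∈ Ioc (0 : ℝ) 1 ∧ ∃ C : ℝ, 0 < C ∧
      ∀ ξ ∈ UI, ∀ η ∈ UI, |Θ ξ - Θ η| ≤ C * |ξ - η| ^ α := by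
  obtain ⟨m, _, hm0, hm1, -, -, hS⟩ := S.exists_slope_bounds hε
  obtain ⟨_, r, -, -, hr0, hr1, hT⟩ := T.exists_slope_bounds hε
  obtain ⟨α, hα, hrm⟩ := exists_exponent hm0 hm1 hr0 hr1
  refine ⟨α, hα, ?_⟩
  have hmα : 0 < m ^ α := Real.rpow_pos_of_pos hm0 α
  set A : ℝ := (m ^ α)⁻¹
  have hA0 : 0 < A := inv_pos.2 hmα
  have hfar : ∀ x ∈ UI, ∀ y ∈ UI, m ≤ |x - y| → |Θ x - Θ y| ≤ A * |x - y| ^ α := by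
    intro x hx y hy h
    refine (abs_sub_le_one_of_mem_UI (hΘ.1 hx) (hΘ.1 hy)).trans ?_
    rw [← inv_mul_cancel₀ hmα.ne']
    exact mul_le_mul_of_nonneg_left (Real.rpow_le_rpow hm0.le h hα.1.le) hA0.le
  have hlen : ∀ c, m ≤ S.branch c 1 - S.branch c 0 := fun c => by
    have := (hS c 1 one_mem_UI 0 zero_mem_UI).1
    rw [abs_of_pos (sub_pos.2 (S.branch_zero_lt_one c))] at this
    simpa using this
  have hstep : ∀ K : ℝ, 0 ≤ K → ∀ t : ℝ, ∀ a, ∀ ξ ∈ UI, ∀ η ∈ UI,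
      |Θ ξ - Θ η| ≤ K * |ξ - η| ^ α + t →
      |Θ (S.branch a ξ) - Θ (S.branch a η)| ≤
        K * |S.branch a ξ - S.branch a η| ^ α + r * t := by
    intro K hK t a ξ hξ η hη h
    rw [hΘ.2 a ξ hξ, hΘ.2 a η hη]
    have h1 := (hT a _ (hΘ.1 hξ) _ (hΘ.1 hη)).2
    have h2 := mul_le_mul_of_nonneg_left h hr0.le
    have h3 : r * |ξ - η| ^ α ≤ |S.branch a ξ - S.branch a η| ^ α := by
      refine (mul_le_mul_of_nonneg_right hrm (Real.rpow_nonneg (abs_nonneg _) α)).trans ?_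
      rw [← Real.mul_rpow hm0.le (abs_nonneg _)]
      exact Real.rpow_le_rpow (by positivity) (hS a ξ hξ η hη).1 hα.1.le
    have h4 := mul_le_mul_of_nonneg_left h3 hK
    linarith
  have hbase : ∀ K : ℝ, 0 ≤ K → ∀ x ∈ UI, ∀ y ∈ UI,
      |Θ x - Θ y| ≤ K * |x - y| ^ α + r ^ 0 := by
    intro K hK x hx y hy
    have := abs_sub_le_one_of_mem_UI (hΘ.1 hx) (hΘ.1 hy)
    have : 0 ≤ K * |x - y| ^ α := by positivity
    rw [pow_zero]
    linarith
  have hne := S.nonempty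
  have hend : ∀ e, e = 0 ∨ e = 1 → ∀ y ∈ UI, |Θ e - Θ y| ≤ A * |e - y| ^ α := by
    intro e he
    have heU : e ∈ UI := by rcases he with rfl | rfl <;> simp
    have hsplit : ∀ b, ∀ η ∈ UI, S.branch b e = e ∨ m ≤ |e - S.branch b η| := by
      intro b η hη
      rcases he with rfl | rfl
      · obtain ⟨a, ha⟩ := exists_forall_le (d := d)
        rcases (ha b).eq_or_lt with rfl | h
        · exact Or.inl (S.branch_first ha)
        · right
          have h1 := hlen a
          have h2 := S.ordered a b h 1 one_mem_UI η hη
          rw [S.branch_first ha] at h1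
          rw [abs_sub_comm]
          exact le_trans (by linarith) (le_abs_self _)
      · obtain ⟨a, ha⟩ := exists_forall_ge (d := d)
        rcases (ha b).eq_or_lt with rfl | h
        · exact Or.inl (S.branch_last ha)
        · right
          have h1 := hlen a
          have h2 := S.ordered b a h η hη 0 zero_mem_UI
          rw [S.branch_last ha] at h1
          exact le_trans (by linarith) (le_abs_self _)
    have key : ∀ n : ℕ, ∀ y ∈ UI, |Θ e - Θ y| ≤ A * |e - y| ^ α + r ^ n := by
      intro n
      induction n with
      | zero => exact fun y hy => hbase A hA0.le e heU y hy
      | succ n ih =>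
        intro y hy
        obtain ⟨b, η, hη, rfl⟩ := S.exists_eq_branch hy
        rcases hsplit b η hη with h | h
        · have := hstep A hA0.le _ b e heU η hη (ih η hη)
          rwa [h, ← pow_succ'] at this
        · have := hfar e heU _ hy h
          have : 0 < r ^ (n + 1) := by positivity
          linarith
    exact fun y hy => le_of_forall_le_add_pow hr0.le hr1 fun n => key n y hy
  have hendBranch : ∀ e, e = 0 ∨ e = 1 → ∀ a, ∀ η ∈ UI,
      |Θ (S.branch a e) - Θ (S.branch a η)| ≤ A * |S.branch a e - S.branch a η| ^ α := by
    intro e he a η hη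
    have heU : e ∈ UI := by rcases he with rfl | rfl <;> simp
    simpa using hstep A hA0.le 0 a e heU η hη (by simpa using hend e he η hη)
  have hcross : ∀ a b, a < b → ∀ ξ ∈ UI, ∀ η ∈ UI,
      |Θ (S.branch a ξ) - Θ (S.branch b η)| ≤ 2 * A * |S.branch a ξ - S.branch b η| ^ α := by
    intro a b hab ξ hξ η hη
    have hord := S.ordered a b hab ξ hξ η hη
    rcases S.adjacent_or_far hlen hab hξ hη with h | h
    · have hadj := S.branch_succ h
      have h1 := hendBranch 1 (Or.inr rfl) a ξ hξ
      have h2 := hendBranch 0 (Or.inl rfl) b η hη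
      have hl := S.branch_le_one a hξ
      have hr := S.branch_zero_le b hη
      rw [← hadj] at h2 hr
      have h3 : |S.branch a 1 - S.branch a ξ| ^ α ≤ |S.branch a ξ - S.branch b η| ^ α := by
        refine Real.rpow_le_rpow (abs_nonneg _) ?_ hα.1.le
        rw [abs_of_nonneg (by linarith), abs_sub_comm, abs_of_nonneg (by linarith)]
        linarith
      have h4 : |S.branch a 1 - S.branch b η| ^ α ≤ |S.branch a ξ - S.branch b η| ^ α := by
        refine Real.rpow_le_rpow (abs_nonneg _) ?_ hα.1.le
        rw [abs_sub_comm, abs_of_nonneg (by linarith), abs_sub_comm, abs_of_nonneg (by linarith)]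
        linarith
      have h5 := abs_sub_le (Θ (S.branch a ξ)) (Θ (S.branch a 1)) (Θ (S.branch b η))
      rw [abs_sub_comm (Θ (S.branch a ξ)) (Θ (S.branch a 1))] at h5
      have h6 := mul_le_mul_of_nonneg_left h3 hA0.le
      have h7 := mul_le_mul_of_nonneg_left h4 hA0.le
      linarith
    · have := hfar _ (S.branch_maps_to a hξ) _ (S.branch_maps_to b hη)
        (by rw [abs_sub_comm]; exact h.trans (le_abs_self _))
      have : 0 ≤ A * |S.branch a ξ - S.branch b η| ^ α := by positivity
      linarith
  have key : ∀ n : ℕ, ∀ x ∈ UI, ∀ y ∈ UI, |Θ x - Θ y| ≤ 2 * A * |x - y| ^ α + r ^ n := by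
    intro n
    induction n with
    | zero => exact hbase (2 * A) (by positivity)
    | succ n ih =>
      intro x hx y hy
      have hrn : 0 < r ^ (n + 1) := by positivity
      obtain ⟨a, ξ, hξ, rfl⟩ := S.exists_eq_branch hx
      obtain ⟨b, η, hη, rfl⟩ := S.exists_eq_branch hy
      rcases lt_trichotomy a b with h | rfl | h
      · linarith [hcross a b h ξ hξ η hη]
      · rw [pow_succ']
        exact hstep (2 * A) (by positivity) _ a ξ hξ η hη (ih ξ hξ η hη)
      · have := hcross b a h η hη ξ hξ
        rw [abs_sub_comm, abs_sub_comm (S.branch b η)] at this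
        linarith
  exact ⟨2 * A, by positivity, fun x hx y hy =>
    le_of_forall_le_add_pow hr0.le hr1 fun n => key n x hx y hy⟩

lemma Intertwines.isConjugacy (hε : 0 < ε) {Θ : ℝ → ℝ} (hΘ : Intertwines S T Θ) :
    IsConjugacy S T Θ := by
  obtain ⟨α, hα, C, -, hC⟩ := hΘ.holder hε
  have hcont : ContinuousOn Θ UI := continuousOn_of_holder hα.1 hC
  have h0 := hΘ.map_zero hε
  have h1 := hΘ.map_one hε
  have hmono : StrictMonoOn Θ UI :=
    hcont.strictMonoOn_of_injOn_Icc zero_le_one (by rw [h0, h1]; exact zero_le_one)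
      (hΘ.injOn hε)
  refine ⟨hmono, hcont, Subset.antisymm hΘ.1.image_subset ?_, fun x hx => ?_⟩
  · have := intermediate_value_Icc zero_le_one hcont
    rwa [h0, h1] at this
  · rcases hx.2.lt_or_eq with hlt | rfl
    · obtain ⟨a, ξ, hξ, rfl⟩ := S.exists_eq_branch_of_lt_one ⟨hx.1, hlt⟩
      have hξU := Ico_subset_Icc_self hξ
      rw [hΘ.2 a ξ hξU, S.right_inv a ξ hξ, T.right_inv]
      refine ⟨(hΘ.1 hξU).1, ?_⟩
      rw [← h1]
      exact hmono hξU one_mem_UI hξ.2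
    · rw [h1, T.map_one, S.map_one, h1]

lemma IsConjugacy.mapsTo_s19 {Θ : ℝ → ℝ} (h : IsConjugacy S T Θ) : MapsTo Θ UI UI :=
  fun _ hx => h.2.2.1 ▸ mem_image_of_mem Θ hx

lemma IsConjugacy.map_zero_s19 {Θ : ℝ → ℝ} (h : IsConjugacy S T Θ) : Θ 0 = 0 := by
  obtain ⟨x, hx, hx0⟩ : (0 : ℝ) ∈ Θ '' UI := h.2.2.1.symm ▸ zero_mem_UI
  exact le_antisymm (hx0 ▸ h.1.monotoneOn zero_mem_UI hx hx.1) (h.mapsTo_s19 zero_mem_UI).1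

lemma IsConjugacy.map_one_s19 {Θ : ℝ → ℝ} (h : IsConjugacy S T Θ) : Θ 1 = 1 := by
  obtain ⟨x, hx, hx1⟩ : (1 : ℝ) ∈ Θ '' UI := h.2.2.1.symm ▸ one_mem_UI
  refine le_antisymm (h.mapsTo_s19 one_mem_UI).2 ?_
  have := h.1.monotoneOn hx one_mem_UI hx.2
  rwa [hx1] at this

lemma IsConjugacy.map_mem_Ico {Θ : ℝ → ℝ} (h : IsConjugacy S T Θ) {x : ℝ}
    (hx : x ∈ Ico (0 : ℝ) 1) : Θ x ∈ Ico (0 : ℝ) 1 := by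
  have hxU := Ico_subset_Icc_self hx
  refine ⟨(h.mapsTo_s19 hxU).1, ?_⟩
  have := h.1 hxU one_mem_UI hx.2
  rwa [h.map_one_s19] at this

lemma ExpMap.branch_mem_Ico (a : Fin d) {ξ : ℝ} (hξ : ξ ∈ Ico (0 : ℝ) 1) :
    S.branch a ξ ∈ Ico (0 : ℝ) 1 := by
  have hξU := Ico_subset_Icc_self hξ
  exact ⟨(S.branch_maps_to a hξU).1, (S.branch_mono a hξU one_mem_UI hξ.2).trans_le
    (S.branch_maps_to a one_mem_UI).2⟩

/-- A conjugacy preserves the left endpoints of the branch images. -/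
lemma IsConjugacy.map_branch_zero {Θ : ℝ → ℝ} (h : IsConjugacy S T Θ) (a : Fin d) :
    Θ (S.branch a 0) = T.branch a 0 := by
  have h0 : (0 : ℝ) ∈ Ico (0 : ℝ) 1 := ⟨le_rfl, zero_lt_one⟩
  have hex : ∀ a, ∃ b, Θ (S.branch a 0) = T.branch b 0 := by
    intro a
    obtain ⟨b, η, hη, hb⟩ := T.exists_eq_branch_of_lt_one (h.map_mem_Ico (S.branch_mem_Ico a h0))
    have hc := h.2.2.2 _ (S.branch_maps_to a zero_mem_UI)
    rw [← hb, T.right_inv b η hη, S.right_inv a 0 h0, h.map_zero_s19] at hc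
    exact ⟨b, by rw [← hb, hc]⟩
  choose σ hσ using hex
  have hmono : StrictMono σ := by
    intro a b hab
    have h1 : S.branch a 0 < S.branch b 0 :=
      (S.branch_zero_lt_one a).trans_le (S.branch_one_le_branch_zero hab)
    have h2 := h.1 (S.branch_maps_to a zero_mem_UI) (S.branch_maps_to b zero_mem_UI) h1
    rw [hσ, hσ] at h2
    by_contra hle
    rcases (not_lt.1 hle).eq_or_lt with heq | hlt
    · rw [heq] at h2
      exact lt_irrefl _ h2
    · exact absurd h2 (not_lt.2 (T.ordered _ _ hlt 0 zero_mem_UI 0 zero_mem_UI))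
  have hid : σ = id := (hmono.range_inj strictMono_id).1 <| by
    rw [range_id, (Finite.injective_iff_surjective.1 hmono.injective).range_eq]
  rw [hσ, hid, id]

lemma IsConjugacy.map_branch_one {Θ : ℝ → ℝ} (h : IsConjugacy S T Θ) (a : Fin d) :
    Θ (S.branch a 1) = T.branch a 1 := by
  rcases Fin.le_all_or_exists_succ a with ha | ⟨b, hb⟩
  · rw [S.branch_last ha, T.branch_last ha, h.map_one_s19]
  · rw [S.branch_succ hb, T.branch_succ hb, h.map_branch_zero]

lemma IsConjugacy.intertwines {Θ : ℝ → ℝ} (h : IsConjugacy S T Θ) : Intertwines S T Θ := by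
  refine ⟨h.mapsTo_s19, fun a ξ hξ => ?_⟩
  rcases hξ.2.lt_or_eq with hlt | rfl
  · have hξI : ξ ∈ Ico (0 : ℝ) 1 := ⟨hξ.1, hlt⟩
    have hxU := S.branch_maps_to a hξ
    obtain ⟨b, η, hη, hb⟩ := T.exists_eq_branch_of_lt_one (h.map_mem_Ico (S.branch_mem_Ico a hξI))
    have hηU := Ico_subset_Icc_self hη
    have hc := h.2.2.2 _ hxU
    rw [← hb, T.right_inv b η hη, S.right_inv a ξ hξI] at hc
    have hleft := h.1.monotoneOn (S.branch_maps_to a zero_mem_UI) hxU (S.branch_zero_le a hξ)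
    have hright := h.1 hxU (S.branch_maps_to a one_mem_UI) (S.branch_mono a hξ one_mem_UI hlt)
    rw [h.map_branch_zero, ← hb] at hleft
    rw [h.map_branch_one, ← hb] at hright
    rcases lt_trichotomy b a with hba | rfl | hab
    · have := T.branch_mono b hηU one_mem_UI hη.2
      have := T.branch_one_le_branch_zero hba
      linarith
    · rw [← hb, hc]
    · have := T.branch_zero_le b hηU
      have := T.branch_one_le_branch_zero hab
      linarith
  · rw [h.map_branch_one, h.map_one_s19]

end Intertwining

/-- For two expanding piecewise `C^{1+ε}` maps `S` and `T` of `𝒰` with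
the same number `d` of branches, there is exactly one increasing homeomorphism
`Θ : 𝒰 → 𝒰` with `T∘Θ = Θ∘S`, and this `Θ` is Hölder continuous: there are `α ∈ (0,1]`
and `C > 0` with `|Θ(ξ)-Θ(η)| ≤ C|ξ-η|^α` on `𝒰`. -/
theorem statement_19 {d : ℕ} {ε : ℝ} (hd : 2 ≤ d) (hε : 0 < ε) (S T : ExpMap d ε) :
    ∃ Θ : ℝ → ℝ, IsConjugacy S T Θ ∧
      (∀ Θ₂ : ℝ → ℝ, IsConjugacy S T Θ₂ → Set.EqOn Θ₂ Θ UI) ∧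
      ∃ α : ℝ, α ∈ Set.Ioc (0 : ℝ) 1 ∧ ∃ C : ℝ, 0 < C ∧
        ∀ ξ ∈ UI, ∀ η ∈ UI, |Θ ξ - Θ η| ≤ C * |ξ - η| ^ α := by
  obtain ⟨Θ, hΘ⟩ := exists_intertwines hε S T
  exact ⟨Θ, hΘ.isConjugacy hε, fun _ h => h.intertwines.eqOn hε hΘ, hΘ.holder hε⟩
end
end
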